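/- arXiv:2405.19080 — 7 statements merged into one kernel-verified Lean document; each statement's English description precedes it below -/
import Mathlib

section
/- Let X be a finite set and let p, q, r be probability mass functions on X with q(x) > 0 and r(x) > 0 for all x ∈ X. Let f : [0,∞) → ℝ be a convex function with f(1) = 0 whose f-divergence upper-bounds the KL divergence, i.e. D_KL(u‖v) ≤ D_f(u‖v) for all probability mass functions u, v on X with v strictly positive. Then D_KL(p‖q) ≤ Σ_{x∈X} p(x)·log(r(x)/q(x)) + D_f(p‖r). -/
/-- Proposition 4.1 of the paper.
If the `f`-divergence upper-bounds the KL divergence, then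
`D_KL(p‖q) ≤ Σ_x p x * log (r x / q x) + D_f(p‖r)`. -/
theorem kl_le_logratio_add_fdiv {X : Type*} [Fintype X]
    (p q r : X → ℝ)
    (hp0 : ∀ x, 0 ≤ p x) (hp1 : ∑ x, p x = 1)
    (hq0 : ∀ x, 0 < q x) (hq1 : ∑ x, q x = 1)
    (hr0 : ∀ x, 0 < r x) (hr1 : ∑ x, r x = 1)
    (f : ℝ → ℝ) (hf : ConvexOn ℝ (Set.Ici (0 : ℝ)) f) (hf1 : f 1 = 0)
    (hKLf : ∀ u v : X → ℝ, (∀ x, 0 ≤ u x) → (∑ x, u x = 1) →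
      (∀ x, 0 < v x) → (∑ x, v x = 1) →
      ∑ x, u x * Real.log (u x / v x) ≤ ∑ x, v x * f (u x / v x)) :
    ∑ x, p x * Real.log (p x / q x) ≤
      (∑ x, p x * Real.log (r x / q x)) + ∑ x, r x * f (p x / r x) := by
  have h := hKLf p r hp0 hp1 hr0 hr1
  have e : ∑ x, p x * Real.log (p x / q x) =
      (∑ x, p x * Real.log (r x / q x)) + ∑ x, p x * Real.log (p x / r x) := by
    rw [← Finset.sum_add_distrib]
    refine Finset.sum_congr rfl fun x _ => ?_
    rcases (hp0 x).eq_or_lt with h0 | h0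
    · simp [← h0]
    · rw [Real.log_div h0.ne' (hq0 x).ne', Real.log_div (hr0 x).ne' (hq0 x).ne',
        Real.log_div h0.ne' (hr0 x).ne']
      ring
  linarith
end

section
/- Let X be a finite set, let p, q, r̂ be probability mass functions on X that are all strictly positive, let r : X → (0,∞), and let f : [0,∞) → ℝ be a convex function with f(1) = 0 whose f-divergence upper-bounds the KL divergence, i.e. D_KL(u‖v) ≤ D_f(u‖v) for all probability mass functions u, v on X with v strictly positive. Then log(Σ_{x∈X} q(x) r(x)) ≥ Σ_{x∈X} p(x)·[log r(x) + log(q(x)/r̂(x))] − D_f(p‖r̂). -/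
/-- surrogate policy learning objective bound, Equation (5) with α = 1.
`log (Σ_x q x * r x) ≥ Σ_x p x * (log (r x) + log (q x / r̂ x)) − D_f(p‖r̂)`,
whenever the `f`-divergence upper-bounds the KL divergence. -/
theorem log_sum_ge_surrogate {X : Type*} [Fintype X]
    (p q rhat : X → ℝ) (r : X → ℝ)
    (hp0 : ∀ x, 0 < p x) (hp1 : ∑ x, p x = 1)
    (hq0 : ∀ x, 0 < q x) (hq1 : ∑ x, q x = 1)
    (hrhat0 : ∀ x, 0 < rhat x) (hrhat1 : ∑ x, rhat x = 1)
    (hr0 : ∀ x, 0 < r x)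
    (f : ℝ → ℝ) (hf : ConvexOn ℝ (Set.Ici (0 : ℝ)) f) (hf1 : f 1 = 0)
    (hKLf : ∀ u v : X → ℝ, (∀ x, 0 ≤ u x) → (∑ x, u x = 1) →
      (∀ x, 0 < v x) → (∑ x, v x = 1) →
      ∑ x, u x * Real.log (u x / v x) ≤ ∑ x, v x * f (u x / v x)) :
    (∑ x, p x * (Real.log (r x) + Real.log (q x / rhat x))) -
      (∑ x, rhat x * f (p x / rhat x)) ≤ Real.log (∑ x, q x * r x) := by
  have hKL := hKLf p rhat (fun x => (hp0 x).le) hp1 hrhat0 hrhat1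
  have hJ := (strictConcaveOn_log_Ioi.concaveOn).le_map_sum (t := Finset.univ) (w := p)
    (p := fun x => q x * r x / p x) (fun x _ => (hp0 x).le) hp1
    (fun x _ => Set.mem_Ioi.2 (div_pos (mul_pos (hq0 x) (hr0 x)) (hp0 x)))
  simp only [smul_eq_mul] at hJ
  have e1 : ∑ x, p x * (q x * r x / p x) = ∑ x, q x * r x :=
    Finset.sum_congr rfl fun x _ => mul_div_cancel₀ _ (hp0 x).ne'
  have e2 : ∑ x, p x * Real.log (q x * r x / p x) =
      (∑ x, p x * (Real.log (r x) + Real.log (q x / rhat x))) -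
        ∑ x, p x * Real.log (p x / rhat x) := by
    rw [← Finset.sum_sub_distrib]
    refine Finset.sum_congr rfl fun x _ => ?_
    have h1 := (hp0 x).ne'
    have h2 := (hq0 x).ne'
    have h3 := (hr0 x).ne'
    have h4 := (hrhat0 x).ne'
    rw [Real.log_div (mul_ne_zero h2 h3) h1, Real.log_mul h2 h3, Real.log_div h2 h4,
      Real.log_div h1 h4]
    ring
  rw [e1, e2] at hJ
  linarith
end

section
/- Let X be a finite set and let p, q be strictly positive probability mass functions on X. Over all functions h : X → (0,1), the objective L(h) = Σ_{x∈X} p(x) log h(x) + Σ_{x∈X} q(x) log(1 − h(x)) is uniquely maximized by h*(x) = p(x)/(p(x)+q(x)). Moreover, for this maximizer, −log(1/h*(x) − 1) = log(p(x)/q(x)) for every x ∈ X; that is, the log-density-ratio of p to q is recovered from the optimal discriminator. -/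
theorem pointwise_strict (a b t : ℝ) (ha : 0 < a) (hb : 0 < b) (ht0 : 0 < t) (ht1 : t < 1)
    (hne : t ≠ a / (a + b)) :
    a * Real.log t + b * Real.log (1 - t) <
      a * Real.log (a / (a + b)) + b * Real.log (1 - a / (a + b)) := by
  have hab : 0 < a + b := by linarith
  have h1t : 0 < 1 - t := by linarith
  have e : 1 - a / (a + b) = b / (a + b) := by field_simp; ring
  have hu : t / (a / (a + b)) ≠ 1 := by
    intro h
    exact hne ((div_eq_one_iff_eq (by positivity)).1 h)
  have h1 := Real.log_lt_sub_one_of_pos (x := t / (a / (a + b))) (by positivity) hu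
  have h2 := Real.log_le_sub_one_of_pos (x := (1 - t) / (b / (a + b))) (by positivity)
  rw [Real.log_div (by positivity) (by positivity)] at h1 h2
  rw [e]
  have h3 := mul_lt_mul_of_pos_left h1 ha
  have h4 := mul_le_mul_of_nonneg_left h2 hb.le
  have e3 : a * (t / (a / (a + b)) - 1) = t * (a + b) - a := by field_simp
  have e4 : b * ((1 - t) / (b / (a + b)) - 1) = (1 - t) * (a + b) - b := by field_simp
  rw [e3] at h3
  rw [e4] at h4
  linarith

/-- optimal discriminator, Equations (8)–(9).
The GAN objective `L h = Σ_x p x * log (h x) + Σ_x q x * log (1 - h x)` over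
`h : X → (0,1)` is uniquely maximized by `h* x = p x / (p x + q x)`, and the
log-density-ratio is recovered as `-log (1 / h* x - 1) = log (p x / q x)`. -/
theorem optimal_discriminator {X : Type*} [Fintype X]
    (p q : X → ℝ)
    (hp0 : ∀ x, 0 < p x) (hp1 : ∑ x, p x = 1)
    (hq0 : ∀ x, 0 < q x) (hq1 : ∑ x, q x = 1) :
    (∀ x, p x / (p x + q x) ∈ Set.Ioo (0 : ℝ) 1) ∧
    (∀ h : X → ℝ, (∀ x, h x ∈ Set.Ioo (0 : ℝ) 1) →
      ((∑ x, p x * Real.log (h x)) + ∑ x, q x * Real.log (1 - h x) ≤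
        (∑ x, p x * Real.log (p x / (p x + q x))) +
          ∑ x, q x * Real.log (1 - p x / (p x + q x))) ∧
      ((∑ x, p x * Real.log (h x)) + ∑ x, q x * Real.log (1 - h x) =
        (∑ x, p x * Real.log (p x / (p x + q x))) +
          ∑ x, q x * Real.log (1 - p x / (p x + q x)) →
        h = fun x => p x / (p x + q x))) ∧
    (∀ x, -Real.log (1 / (p x / (p x + q x)) - 1) = Real.log (p x / q x)) := by
  have hle : ∀ (x : X) (t : ℝ), t ∈ Set.Ioo (0 : ℝ) 1 →
      p x * Real.log t + q x * Real.log (1 - t) ≤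
        p x * Real.log (p x / (p x + q x)) + q x * Real.log (1 - p x / (p x + q x)) := by
    intro x t ht
    by_cases hne : t = p x / (p x + q x)
    · rw [hne]
    · exact (pointwise_strict _ _ t (hp0 x) (hq0 x) ht.1 ht.2 hne).le
  refine ⟨?_, ?_, ?_⟩
  · intro x
    have := hp0 x
    have := hq0 x
    refine ⟨by positivity, ?_⟩
    rw [div_lt_one (by positivity)]
    linarith
  · intro h hh
    simp only [← Finset.sum_add_distrib]
    refine ⟨Finset.sum_le_sum fun x _ => hle x _ (hh x), ?_⟩
    intro heq
    funext x
    by_contra hne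
    refine absurd heq (ne_of_lt (Finset.sum_lt_sum (fun x _ => hle x _ (hh x)) ?_))
    exact ⟨x, Finset.mem_univ x,
      pointwise_strict _ _ _ (hp0 x) (hq0 x) (hh x).1 (hh x).2 hne⟩
  · intro x
    have := hp0 x
    have := hq0 x
    rw [← Real.log_inv]
    congr 1
    have e : 1 / (p x / (p x + q x)) - 1 = q x / p x := by
      field_simp
      ring
    rw [e, inv_div]
end

section
/- Let X be a finite set, let q be a strictly positive probability mass function on X, let Ψ : X → ℝ, let α > 0, and let f : [0,∞) → ℝ be a convex function with f(1) = 0 such that f⋆(y) := sup_{t≥0} (t·y − f(t)) is finite for every y ∈ ℝ. For a nonnegative function ρ : X → [0,∞) define D_f(ρ‖q) = Σ_x q(x) f(ρ(x)/q(x)). Then sup over all ρ : X → [0,∞) of [Σ_{x∈X} ρ(x)Ψ(x) − α·D_f(ρ‖q)] equals α·Σ_{x∈X} q(x)·f⋆(Ψ(x)/α). -/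
/-- core of Proposition 4.3.
The supremum over nonnegative `ρ` of `Σ_x ρ x * Ψ x − α * D_f(ρ‖q)` equals
`α * Σ_x q x * f⋆ (Ψ x / α)`, where `f⋆ y = sup_{t ≥ 0} (t * y − f t)`. -/
theorem sup_rho_eq_conjugate_expectation {X : Type*} [Fintype X]
    (q : X → ℝ) (hq0 : ∀ x, 0 < q x) (hq1 : ∑ x, q x = 1)
    (Ψ : X → ℝ) (α : ℝ) (hα : 0 < α)
    (f : ℝ → ℝ) (hf : ConvexOn ℝ (Set.Ici (0 : ℝ)) f) (hf1 : f 1 = 0)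
    (fstar : ℝ → ℝ)
    (hfstar : ∀ y : ℝ,
      IsLUB {z : ℝ | ∃ t : ℝ, 0 ≤ t ∧ z = t * y - f t} (fstar y)) :
    IsLUB {z : ℝ | ∃ ρ : X → ℝ, (∀ x, 0 ≤ ρ x) ∧
        z = (∑ x, ρ x * Ψ x) - α * ∑ x, q x * f (ρ x / q x)}
      (α * ∑ x, q x * fstar (Ψ x / α)) := by
  have key : ∀ t : X → ℝ, (∑ x, (q x * t x) * Ψ x) - α * ∑ x, q x * f (t x)
      = α * ∑ x, q x * (t x * (Ψ x / α) - f (t x)) := by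
    intro t
    rw [Finset.mul_sum, Finset.mul_sum, ← Finset.sum_sub_distrib]
    refine Finset.sum_congr rfl fun x _ => ?_
    field_simp
  constructor
  · rintro z ⟨ρ, hρ, rfl⟩
    have h := key (fun x => ρ x / q x)
    have h2 : ∀ x, q x * (ρ x / q x) = ρ x := fun x => mul_div_cancel₀ _ (hq0 x).ne'
    simp only [h2] at h
    rw [h]
    refine mul_le_mul_of_nonneg_left (Finset.sum_le_sum fun x _ => ?_) hα.le
    exact mul_le_mul_of_nonneg_left
      ((hfstar (Ψ x / α)).1 ⟨ρ x / q x, div_nonneg (hρ x) (hq0 x).le, rfl⟩) (hq0 x).le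
  · intro b hb
    refine le_of_forall_pos_le_add fun ε hε => ?_
    have hex : ∀ x, ∃ t : ℝ, 0 ≤ t ∧ fstar (Ψ x / α) - ε / α < t * (Ψ x / α) - f t := by
      intro x
      have hlt : fstar (Ψ x / α) - ε / α < fstar (Ψ x / α) := sub_lt_self _ (div_pos hε hα)
      obtain ⟨z, ⟨t, ht, rfl⟩, hz⟩ := (lt_isLUB_iff (hfstar (Ψ x / α))).1 hlt
      exact ⟨t, ht, hz⟩
    choose t ht0 ht using hex
    have h1 : α * ∑ x, q x * (t x * (Ψ x / α) - f (t x)) ≤ b := by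
      refine hb ⟨fun x => q x * t x, fun x => mul_nonneg (hq0 x).le (ht0 x), ?_⟩
      rw [← key t]
      have h2 : ∀ x, q x * t x / q x = t x := fun x => mul_div_cancel_left₀ _ (hq0 x).ne'
      simp only [h2]
    have h3 : ∑ x, q x * (fstar (Ψ x / α) - ε / α)
        ≤ ∑ x, q x * (t x * (Ψ x / α) - f (t x)) :=
      Finset.sum_le_sum fun x _ => mul_le_mul_of_nonneg_left (ht x).le (hq0 x).le
    have h4 : ∑ x, q x * (fstar (Ψ x / α) - ε / α)
        = ∑ x, q x * fstar (Ψ x / α) - ε / α := by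
      simp only [mul_sub, Finset.sum_sub_distrib]
      rw [← Finset.sum_mul, hq1, one_mul]
    rw [h4] at h3
    have h5 := mul_le_mul_of_nonneg_left h3 hα.le
    rw [mul_sub, mul_div_cancel₀ _ hα.ne'] at h5
    linarith
end

section
/- Let X be a finite set, let q be a strictly positive probability mass function on X, let ρ be a probability mass function on X, and let f : ℝ → ℝ ∪ {+∞} be a proper convex lower semicontinuous function with f(t) = +∞ for t < 0 and f(1) = 0. Let f⋆(y) = sup_{t∈ℝ} (t·y − f(t)) be its convex conjugate. Then D_f(ρ‖q) = sup over all functions y : X → ℝ of [Σ_{x∈X} ρ(x)·y(x) − Σ_{x∈X} q(x)·f⋆(y(x))], where D_f(ρ‖q) = Σ_x q(x) f(ρ(x)/q(x)). -/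
open scoped BigOperators

lemma aux_sep (f : ℝ → EReal)
    (hproper : ∀ t, f t ≠ ⊥)
    (hconv : ∀ t₁ t₂ : ℝ, ∀ l : ℝ, 0 ≤ l → l ≤ 1 →
      f (l * t₁ + (1 - l) * t₂) ≤ (l : EReal) * f t₁ + ((1 - l : ℝ) : EReal) * f t₂)
    (hlsc : LowerSemicontinuous f) (hf1 : f 1 = 0) (t0 c : ℝ) (hc : (c : EReal) < f t0) :
    ∃ a β u : ℝ, 0 ≤ β ∧ a * t0 + β * c < u ∧
      ∀ t s : ℝ, f t ≤ s → u < a * t + β * s := by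
  have hcl : IsClosed {p : ℝ × ℝ | f p.1 ≤ (p.2 : EReal)} := by
    have h := hlsc.isClosed_epigraph
    exact h.preimage (f := fun p : ℝ × ℝ => (p.1, (p.2 : EReal)))
      (continuous_fst.prodMk (continuous_coe_real_ereal.comp continuous_snd))
  have hcv : Convex ℝ {p : ℝ × ℝ | f p.1 ≤ (p.2 : EReal)} := by
    rintro ⟨t, s⟩ h1 ⟨t', s'⟩ h2 l m hl hm hlm
    obtain rfl : m = 1 - l := by linarith
    simp only [Set.mem_ofPred_eq] at h1 h2
    simp only [Set.mem_ofPred_eq, Prod.fst_add, Prod.snd_add, Prod.smul_mk, smul_eq_mul]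
    refine (hconv t t' l hl (by linarith)).trans ?_
    rw [EReal.coe_add, EReal.coe_mul, EReal.coe_mul]
    exact add_le_add (mul_le_mul_of_nonneg_left h1 (by exact_mod_cast hl))
      (mul_le_mul_of_nonneg_left h2 (by exact_mod_cast hm))
  obtain ⟨g, u, h1, h2⟩ := geometric_hahn_banach_point_closed (x := ((t0, c) : ℝ × ℝ)) hcv hcl
    (by simpa using hc)
  have hg : ∀ t s : ℝ, g (t, s) = g (1, 0) * t + g (0, 1) * s := by
    intro t s
    have : ((t, s) : ℝ × ℝ) = t • ((1, 0) : ℝ × ℝ) + s • ((0, 1) : ℝ × ℝ) := by simp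
    rw [this, map_add, map_smul, map_smul]
    simp only [smul_eq_mul]; ring
  have h3 : ∀ t s : ℝ, f t ≤ s → u < g (1, 0) * t + g (0, 1) * s := by
    intro t s h
    rw [← hg]; exact h2 (t, s) h
  refine ⟨g (1, 0), g (0, 1), u, ?_, by rw [← hg]; exact h1, h3⟩
  by_contra! hb
  set β := g (0, 1)
  set a := g (1, 0)
  have hpos : 0 ≤ |u - a| / (-β) := div_nonneg (abs_nonneg _) (by linarith)
  have h := h3 1 (|u - a| / (-β)) (by rw [hf1]; exact_mod_cast hpos)
  have e : β * (|u - a| / (-β)) = -|u - a| := by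
    have hb0 : β ≠ 0 := hb.ne
    rw [div_neg, mul_neg, mul_div_cancel₀ _ hb0]
  rw [e] at h
  linarith [neg_abs_le (u - a), le_abs_self (u-a)]

lemma aux_min (f : ℝ → EReal)
    (hproper : ∀ t, f t ≠ ⊥)
    (hconv : ∀ t₁ t₂ : ℝ, ∀ l : ℝ, 0 ≤ l → l ≤ 1 →
      f (l * t₁ + (1 - l) * t₂) ≤ (l : EReal) * f t₁ + ((1 - l : ℝ) : EReal) * f t₂)
    (hlsc : LowerSemicontinuous f) (hf1 : f 1 = 0) (t0 c : ℝ) (hc : (c : EReal) < f t0) :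
    ∃ y b : ℝ, c ≤ y * t0 - b ∧ ∀ t s : ℝ, f t ≤ s → y * t - b ≤ s := by
  have key : ∀ t0 c a β u : ℝ, 0 < β → a * t0 + β * c < u → 
      (∀ t s : ℝ, f t ≤ s → u < a * t + β * s) →
      ∃ y b : ℝ, c ≤ y * t0 - b ∧ ∀ t s : ℝ, f t ≤ s → y * t - b ≤ s := by
    intro t0 c a β u hβ h1 h2
    refine ⟨-a / β, -u / β, ?_, ?_⟩
    · have : -a / β * t0 - -u / β = (u - a * t0) / β := by ring
      rw [this, le_div_iff₀ hβ]; linarith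
    · intro t s h
      have : -a / β * t - -u / β = (u - a * t) / β := by ring
      rw [this, div_le_iff₀ hβ]; linarith [h2 t s h]
  obtain ⟨a, β, u, hβ, h1, h2⟩ := aux_sep f hproper hconv hlsc hf1 t0 c hc
  rcases hβ.lt_or_eq with hβ | rfl
  · exact key t0 c a β u hβ h1 h2
  obtain ⟨a', β', u', hβ', h1', h2'⟩ := aux_sep f hproper hconv hlsc hf1 1 (-1)
    (by rw [hf1]; exact_mod_cast (by norm_num : (-1:ℝ) < 0))
  have h01 := h2' 1 0 (by rw [hf1]; simp)
  obtain ⟨y, b, -, hm⟩ := key 1 (-1) a' β' u' (by linarith) h1' h2'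
  have hd : 0 < u - a * t0 := by linarith
  set k := |c - (y * t0 - b)| / (u - a * t0)
  have hk : 0 ≤ k := by positivity
  have hk' : k * (u - a * t0) = |c - (y * t0 - b)| := by
    exact div_mul_cancel₀ _ hd.ne'
  refine ⟨y - k * a, b - k * u, ?_, ?_⟩
  · linarith [le_abs_self (c - (y * t0 - b))]
  · intro t s h
    have := hm t s h
    have h3 := h2 t s h
    nlinarith [mul_nonneg hk (by linarith : 0 ≤ a * t - u)]

lemma aux_conj (f : ℝ → EReal)
    (hproper : ∀ t, f t ≠ ⊥)
    (hconv : ∀ t₁ t₂ : ℝ, ∀ l : ℝ, 0 ≤ l → l ≤ 1 →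
      f (l * t₁ + (1 - l) * t₂) ≤ (l : EReal) * f t₁ + ((1 - l : ℝ) : EReal) * f t₂)
    (hlsc : LowerSemicontinuous f) (hf1 : f 1 = 0) (r q c : ℝ) (hq : 0 < q)
    (hc : (c : EReal) < (q : EReal) * f (r / q)) :
    ∃ y b : ℝ, c ≤ r * y - q * b ∧ (⨆ t : ℝ, (((t * y : ℝ) : EReal) - f t)) ≤ b := by
  have h : ((c / q : ℝ) : EReal) < f (r / q) := by
    generalize f (r / q) = z at hc
    induction z with
    | bot => rw [EReal.coe_mul_bot_of_pos hq] at hc; simp at hc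
    | top => exact EReal.coe_lt_top _
    | coe z =>
      norm_cast at hc ⊢
      rw [div_lt_iff₀ hq]; linarith
  obtain ⟨y, b, h1, h2⟩ := aux_min f hproper hconv hlsc hf1 _ _ h
  refine ⟨y, b, ?_, ?_⟩
  · rw [div_le_iff₀ hq] at h1
    have : (y * (r / q) - b) * q = r * y - q * b := by field_simp
    linarith
  · refine iSup_le fun t => ?_
    have h3 := h2 t
    have h4 := hproper t
    generalize f t = z at h3 h4
    induction z with
    | bot => exact absurd rfl h4
    | top => simp
    | coe z =>
      have := h3 z le_rfl
      norm_cast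
      linarith

lemma aux_sum_ne_bot {X : Type*} (s : Finset X) (g : X → EReal) (hg : ∀ x, g x ≠ ⊥) :
    ∑ x ∈ s, g x ≠ ⊥ := by
  classical
  induction s using Finset.induction_on with
  | empty => simp
  | insert i s hi ih =>
    rw [Finset.sum_insert hi]
    simp [EReal.add_eq_bot_iff, hg, ih]

lemma aux_coe_sum {X : Type*} (s : Finset X) (g : X → ℝ) :
    ((∑ x ∈ s, g x : ℝ) : EReal) = ∑ x ∈ s, (g x : EReal) := by
  classical
  induction s using Finset.induction_on with
  | empty => simp
  | insert i s hi ih =>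
    rw [Finset.sum_insert hi, Finset.sum_insert hi, EReal.coe_add, ih]

lemma aux_sum_approx {X : Type*} (s : Finset X) (g : X → EReal) (hg : ∀ x, g x ≠ ⊥) :
    ∀ a : EReal, a < ∑ x ∈ s, g x →
      ∃ c : X → ℝ, (∀ x, (c x : EReal) < g x) ∧ a ≤ ((∑ x ∈ s, c x : ℝ) : EReal) := by
  classical
  induction s using Finset.induction_on with
  | empty =>
    intro a ha
    have : ∀ x, ∃ c : ℝ, (c : EReal) < g x := fun x => by
      obtain ⟨c, -, h⟩ := EReal.lt_iff_exists_real_btwn.1 (bot_lt_iff_ne_bot.2 (hg x))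
      exact ⟨c, h⟩
    choose c hc using this
    exact ⟨c, hc, by simpa using ha.le⟩
  | insert i s hi ih =>
    intro a ha
    rw [Finset.sum_insert hi] at ha
    by_contra! hcon
    refine absurd ha (not_lt.2 (EReal.add_le_of_forall_lt fun a' ha' b' hb' => ?_))
    obtain ⟨r, hr1, hr2⟩ := EReal.lt_iff_exists_real_btwn.1 ha'
    obtain ⟨c, hc1, hc2⟩ := ih b' hb'
    have := hcon (Function.update c i r) (fun x => by
      by_cases h : x = i
      · subst h; simpa using hr2
      · simpa [h] using hc1 x)
    rw [Finset.sum_insert hi, Finset.sum_update_of_notMem hi, Function.update_self,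
      EReal.coe_add] at this
    exact (add_le_add hr1.le hc2).trans this.le

lemma aux_mul_ne_bot (q : ℝ) (hq : 0 < q) (z : EReal) (hz : z ≠ ⊥) : (q : EReal) * z ≠ ⊥ := by
  induction z with
  | bot => exact absurd rfl hz
  | top => simp [EReal.coe_mul_top_of_pos hq]
  | coe z => exact EReal.coe_ne_bot (q * z)

/-- Fenchel variational representation of the f-divergence,
Equation (15) of Appendix A.3. For a proper convex lower semicontinuous
`f : ℝ → ℝ ∪ {+∞}` with `f t = +∞` for `t < 0` and `f 1 = 0`,
`D_f(ρ‖q) = sup_{y : X → ℝ} [Σ_x ρ x * y x − Σ_x q x * f⋆(y x)]`. -/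
theorem fdiv_eq_sup_fenchel {X : Type*} [Fintype X]
    (q : X → ℝ) (hq0 : ∀ x, 0 < q x) (hq1 : ∑ x, q x = 1)
    (ρ : X → ℝ) (hρ0 : ∀ x, 0 ≤ ρ x) (hρ1 : ∑ x, ρ x = 1)
    (f : ℝ → EReal)
    (hproper : ∀ t, f t ≠ ⊥)
    (hconv : ∀ t₁ t₂ : ℝ, ∀ l : ℝ, 0 ≤ l → l ≤ 1 →
      f (l * t₁ + (1 - l) * t₂) ≤ (l : EReal) * f t₁ + ((1 - l : ℝ) : EReal) * f t₂)
    (hlsc : LowerSemicontinuous f)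
    (hneg : ∀ t : ℝ, t < 0 → f t = ⊤)
    (hf1 : f 1 = 0) :
    ∑ x, (q x : EReal) * f (ρ x / q x) =
      ⨆ y : X → ℝ,
        (((∑ x, ρ x * y x : ℝ) : EReal) -
          ∑ x, (q x : EReal) * ⨆ t : ℝ, (((t * y x : ℝ) : EReal) - f t)) := by
  have hne : ∀ x, (q x : EReal) * f (ρ x / q x) ≠ ⊥ := fun x =>
    aux_mul_ne_bot _ (hq0 x) _ (hproper _)
  apply le_antisymm
  · refine le_of_forall_lt_imp_le_of_dense fun a ha => ?_
    obtain ⟨c, hc1, hc2⟩ := aux_sum_approx _ _ hne a ha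
    choose y b h1 h2 using fun x =>
      aux_conj f hproper hconv hlsc hf1 (ρ x) (q x) (c x) (hq0 x) (hc1 x)
    refine hc2.trans (le_trans ?_ (le_iSup _ y))
    have h3 : ∑ x, (q x : EReal) * (⨆ t : ℝ, (((t * y x : ℝ) : EReal) - f t)) ≤
        ((∑ x, q x * b x : ℝ) : EReal) := by
      rw [aux_coe_sum]
      refine Finset.sum_le_sum fun x _ => ?_
      rw [EReal.coe_mul]
      exact mul_le_mul_of_nonneg_left (h2 x) (by exact_mod_cast (hq0 x).le)
    refine le_trans ?_ (EReal.sub_le_sub le_rfl h3)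
    rw [← EReal.coe_sub, EReal.coe_le_coe_iff, ← Finset.sum_sub_distrib]
    exact Finset.sum_le_sum fun x _ => h1 x
  · refine iSup_le fun y => ?_
    have hF : ∀ x, (⨆ t : ℝ, (((t * y x : ℝ) : EReal) - f t)) ≠ ⊥ := fun x => by
      intro h
      have := le_iSup (fun t : ℝ => (((t * y x : ℝ) : EReal) - f t)) 1
      rw [h, hf1] at this
      simp at this
    rw [EReal.sub_le_iff_le_add
      (Or.inl (aux_sum_ne_bot _ _ fun x => aux_mul_ne_bot _ (hq0 x) _ (hF x)))
      (Or.inr (aux_sum_ne_bot _ _ hne)), ← Finset.sum_add_distrib, aux_coe_sum]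
    refine Finset.sum_le_sum fun x _ => ?_
    have h := le_iSup (fun t : ℝ => (((t * y x : ℝ) : EReal) - f t)) (ρ x / q x)
    have hF' := hF x
    have hp := hproper (ρ x / q x)
    have hq := hq0 x
    generalize (⨆ t : ℝ, (((t * y x : ℝ) : EReal) - f t)) = F at *
    generalize f (ρ x / q x) = z at *
    induction z with
    | bot => exact absurd rfl hp
    | top =>
      rw [EReal.coe_mul_top_of_pos hq, EReal.top_add_of_ne_bot (aux_mul_ne_bot _ hq _ hF')]
      exact le_top
    | coe z =>
      induction F with
      | bot => exact absurd rfl hF'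
      | top =>
        rw [EReal.coe_mul_top_of_pos hq, EReal.add_top_of_ne_bot (aux_mul_ne_bot _ hq _ hp)]
        exact le_top
      | coe F =>
        norm_cast at h ⊢
        have h5 := mul_le_mul_of_nonneg_left h hq.le
        have : q x * (ρ x / q x * y x - z) = ρ x * y x - q x * z := by field_simp
        linarith
end

section
/- Let S and A be finite sets, μ0 a probability mass function on S, π : S → Δ(A) a policy, γ ∈ (0,1), α > 0, r : S × A → (0,∞), R : S × A × S → ℝ, Q : S × A → ℝ, and let ρ̂ be a strictly positive probability mass function on S × A × S. Let f : [0,∞) → ℝ be convex with f(1) = 0 such that f⋆(y) := sup_{t≥0}(t·y − f(t)) is finite for all y ∈ ℝ. Define Ψ(s,a,s') = log r(s,a) − α·R(s,a,s') + γ·Σ_{a'} π(a'|s')·Q(s',a') − Q(s,a). Then sup over all ρ : S × A × S → [0,∞) of [(1−γ)·Σ_{s,a} μ0(s)π(a|s)Q(s,a) + Σ_{s,a,s'} ρ(s,a,s')·Ψ(s,a,s') − α·D_f(ρ‖ρ̂)] = (1−γ)·Σ_{s,a} μ0(s)π(a|s)Q(s,a) + α·Σ_{s,a,s'} ρ̂(s,a,s')·f⋆(Ψ(s,a,s')/α),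 where D_f(ρ‖ρ̂) = Σ_{s,a,s'} ρ̂(s,a,s')·f(ρ(s,a,s')/ρ̂(s,a,s')). -/
/-- Proposition 4.3 instantiated on finite state and action
spaces. For fixed policy `π` and multiplier `Q`, the inner supremum over the
unknown transition occupancy `ρ` equals a tractable expectation of the Fenchel
conjugate under the replay-buffer distribution `ρ̂`. -/
theorem prop43_inner_sup {S A : Type*} [Fintype S] [Fintype A]
    (μ0 : S → ℝ) (hμ00 : ∀ s, 0 ≤ μ0 s) (hμ01 : ∑ s, μ0 s = 1)
    (π : S → A → ℝ) (hπ0 : ∀ s a, 0 ≤ π s a) (hπ1 : ∀ s, ∑ a, π s a = 1)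
    (γ : ℝ) (hγ0 : 0 < γ) (hγ1 : γ < 1)
    (α : ℝ) (hα : 0 < α)
    (r : S → A → ℝ) (hr : ∀ s a, 0 < r s a)
    (R : S → A → S → ℝ) (Q : S → A → ℝ)
    (ρhat : S → A → S → ℝ) (hρhat0 : ∀ s a s', 0 < ρhat s a s')
    (hρhat1 : ∑ s, ∑ a, ∑ s', ρhat s a s' = 1)
    (f : ℝ → ℝ) (hf : ConvexOn ℝ (Set.Ici (0 : ℝ)) f) (hf1 : f 1 = 0)
    (fstar : ℝ → ℝ)
    (hfstar : ∀ y : ℝ,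
      IsLUB {z : ℝ | ∃ t : ℝ, 0 ≤ t ∧ z = t * y - f t} (fstar y))
    (Ψ : S → A → S → ℝ)
    (hΨ : ∀ s a s', Ψ s a s' =
      Real.log (r s a) - α * R s a s' +
        γ * (∑ a', π s' a' * Q s' a') - Q s a) :
    IsLUB {z : ℝ | ∃ ρ : S → A → S → ℝ, (∀ s a s', 0 ≤ ρ s a s') ∧
        z = (1 - γ) * (∑ s, ∑ a, μ0 s * π s a * Q s a) +
            (∑ s, ∑ a, ∑ s', ρ s a s' * Ψ s a s') -
            α * ∑ s, ∑ a, ∑ s', ρhat s a s' * f (ρ s a s' / ρhat s a s')}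
      ((1 - γ) * (∑ s, ∑ a, μ0 s * π s a * Q s a) +
        α * ∑ s, ∑ a, ∑ s', ρhat s a s' * fstar (Ψ s a s' / α)) := by
  have key : ∀ ρ : S → A → S → ℝ,
      (∑ s, ∑ a, ∑ s', ρ s a s' * Ψ s a s') -
        α * ∑ s, ∑ a, ∑ s', ρhat s a s' * f (ρ s a s' / ρhat s a s') =
      α * ∑ s, ∑ a, ∑ s', ρhat s a s' *
        (ρ s a s' / ρhat s a s' * (Ψ s a s' / α) - f (ρ s a s' / ρhat s a s')) := by
    intro ρ
    simp only [Finset.mul_sum, ← Finset.sum_sub_distrib]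
    refine Finset.sum_congr rfl fun s _ => Finset.sum_congr rfl fun a _ =>
      Finset.sum_congr rfl fun s' _ => ?_
    have h1 := (hρhat0 s a s').ne'
    have h2 : ρhat s a s' * (ρ s a s' / ρhat s a s') = ρ s a s' := by field_simp
    have h3 : α * (Ψ s a s' / α) = Ψ s a s' := by field_simp
    generalize f (ρ s a s' / ρhat s a s') = w
    calc _ = (ρhat s a s' * (ρ s a s' / ρhat s a s')) * (α * (Ψ s a s' / α))
          - α * (ρhat s a s' * w) := by rw [h2, h3]
      _ = _ := by ring
  constructor
  · rintro z ⟨ρ, hρ, rfl⟩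
    rw [add_sub_assoc, key]
    gcongr with s _ a _ s' _
    · exact (hρhat0 s a s').le
    · exact (hfstar _).1 ⟨_, div_nonneg (hρ s a s') (hρhat0 s a s').le, rfl⟩
  · intro b hb
    refine le_of_forall_pos_le_add fun ε hε => ?_
    have hex : ∀ s a s', ∃ t : ℝ, 0 ≤ t ∧
        fstar (Ψ s a s' / α) - ε / α < t * (Ψ s a s' / α) - f t := by
      intro s a s'
      obtain ⟨z, ⟨t, ht, rfl⟩, hz, -⟩ :=
        (hfstar (Ψ s a s' / α)).exists_between (sub_lt_self _ (div_pos hε hα))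
      exact ⟨t, ht, hz⟩
    choose t ht0 ht using hex
    have hb' := hb ⟨fun s a s' => t s a s' * ρhat s a s',
      fun s a s' => mul_nonneg (ht0 s a s') (hρhat0 s a s').le, rfl⟩
    rw [add_sub_assoc, key] at hb'
    have h1 : ∑ s, ∑ a, ∑ s', ρhat s a s' * (fstar (Ψ s a s' / α) - ε / α) ≤
        ∑ s, ∑ a, ∑ s', ρhat s a s' *
        (t s a s' * ρhat s a s' / ρhat s a s' * (Ψ s a s' / α) -
          f (t s a s' * ρhat s a s' / ρhat s a s')) := by
      refine Finset.sum_le_sum fun s _ => Finset.sum_le_sum fun a _ =>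
        Finset.sum_le_sum fun s' _ => ?_
      rw [mul_div_cancel_right₀ _ (hρhat0 s a s').ne']
      exact mul_le_mul_of_nonneg_left (ht s a s').le (hρhat0 s a s').le
    simp only [mul_sub, Finset.sum_sub_distrib, ← Finset.sum_mul, hρhat1] at h1
    simp only [mul_sub, Finset.sum_sub_distrib] at hb'
    have h2 := mul_le_mul_of_nonneg_left h1 hα.le
    have h3 : α * (ε / α) = ε := by field_simp
    rw [mul_sub, one_mul, h3] at h2
    linarith
end

section
/- Consider a finite MDP with finite state space S, finite action space A, transition kernel T : S × A → Δ(S), initial distribution μ0 ∈ Δ(S), policy π : S → Δ(A), and discount factor γ ∈ (0,1). If a function ρ : S × A → ℝ satisfies the Bellman flow equation ρ(s,a) = (1−γ)·μ0(s)·π(a|s) + γ·π(a|s)·Σ_{(ŝ,â)} T(s|ŝ,â)·ρ(ŝ,â) for every (s,a) ∈ S × A, then ρ equals the state-action occupancy measure ρ^π, i.e. ρ(s,a) = (1−γ)·Σ_{t=0}^∞ γ^t·Pr[s_t = s, a_t = a] for all (s,a). In particular, the Bellman flow equation has a unique solution. -/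
/-- The marginal distribution of the state `s_t` of the Markov chain with
`s_0 ∼ μ0`, `a_t ∼ π (· | s_t)`, `s_{t+1} ∼ T (· | s_t, a_t)`. -/
noncomputable def stateDist {S A : Type*} [Fintype S] [Fintype A]
    (μ0 : S → ℝ) (π : S → A → ℝ) (T : S → A → S → ℝ) : ℕ → S → ℝ
  | 0, s => μ0 s
  | t + 1, s' => ∑ s : S, ∑ a : A, stateDist μ0 π T t s * π s a * T s a s'

theorem stateDist_lin {S A : Type*} [Fintype S] [Fintype A]
    (π : S → A → ℝ) (T : S → A → S → ℝ) (μ ν : S → ℝ) (a b : ℝ) (n : ℕ) :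
    ∀ s, stateDist (fun s => a * μ s + b * ν s) π T n s =
      a * stateDist μ π T n s + b * stateDist ν π T n s := by
  induction n with
  | zero => intro s; simp [stateDist]
  | succ n ih =>
    intro s
    simp only [stateDist, ih, Finset.mul_sum, ← Finset.sum_add_distrib]
    refine Finset.sum_congr rfl fun x _ => Finset.sum_congr rfl fun y _ => ?_
    ring

theorem stateDist_shift {S A : Type*} [Fintype S] [Fintype A]
    (π : S → A → ℝ) (T : S → A → S → ℝ) (μ : S → ℝ) (n : ℕ) :
    ∀ s, stateDist (stateDist μ π T 1) π T n s = stateDist μ π T (n + 1) s := by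
  induction n with
  | zero => intro s; simp [stateDist]
  | succ n ih =>
    intro s
    rw [stateDist, stateDist]
    simp only [ih]

theorem stateDist_l1 {S A : Type*} [Fintype S] [Fintype A]
    (π : S → A → ℝ) (hπ0 : ∀ s a, 0 ≤ π s a) (hπ1 : ∀ s, ∑ a, π s a = 1)
    (T : S → A → S → ℝ) (hT0 : ∀ s a s', 0 ≤ T s a s')
    (hT1 : ∀ s a, ∑ s', T s a s' = 1) (μ : S → ℝ) (n : ℕ) :
    ∑ s, |stateDist μ π T n s| ≤ ∑ s, |μ s| := by
  induction n with
  | zero => simp [stateDist]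
  | succ n ih =>
    refine le_trans ?_ ih
    calc ∑ s', |stateDist μ π T (n + 1) s'|
        ≤ ∑ s', ∑ s, ∑ a, |stateDist μ π T n s| * π s a * T s a s' := by
          refine Finset.sum_le_sum fun s' _ => ?_
          rw [stateDist]
          refine (Finset.abs_sum_le_sum_abs _ _).trans (Finset.sum_le_sum fun s _ => ?_)
          refine (Finset.abs_sum_le_sum_abs _ _).trans (Finset.sum_le_sum fun a _ => ?_)
          rw [abs_mul, abs_mul, abs_of_nonneg (hπ0 s a), abs_of_nonneg (hT0 s a s')]
      _ = ∑ s, |stateDist μ π T n s| := by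
          rw [Finset.sum_comm]
          refine Finset.sum_congr rfl fun s _ => ?_
          rw [Finset.sum_comm]
          simp only [← Finset.mul_sum, hT1, hπ1, mul_one]

theorem stateDist_bound {S A : Type*} [Fintype S] [Fintype A]
    (π : S → A → ℝ) (hπ0 : ∀ s a, 0 ≤ π s a) (hπ1 : ∀ s, ∑ a, π s a = 1)
    (T : S → A → S → ℝ) (hT0 : ∀ s a s', 0 ≤ T s a s')
    (hT1 : ∀ s a, ∑ s', T s a s' = 1) (μ : S → ℝ) (n : ℕ) (s : S) :
    |stateDist μ π T n s| ≤ ∑ s, |μ s| :=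
  (Finset.single_le_sum (f := fun s => |stateDist μ π T n s|)
    (fun _ _ => abs_nonneg _) (Finset.mem_univ s)).trans
    (stateDist_l1 π hπ0 hπ1 T hT0 hT1 μ n)

/-- uniqueness of the Bellman flow solution.
Any `ρ : S × A → ℝ` satisfying the Bellman flow equation equals the
state-action occupancy measure `ρ^π`. -/
theorem bellman_flow_unique {S A : Type*} [Fintype S] [Fintype A]
    (μ0 : S → ℝ) (hμ00 : ∀ s, 0 ≤ μ0 s) (hμ01 : ∑ s, μ0 s = 1)
    (π : S → A → ℝ) (hπ0 : ∀ s a, 0 ≤ π s a) (hπ1 : ∀ s, ∑ a, π s a = 1)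
    (T : S → A → S → ℝ) (hT0 : ∀ s a s', 0 ≤ T s a s')
    (hT1 : ∀ s a, ∑ s', T s a s' = 1)
    (γ : ℝ) (hγ0 : 0 < γ) (hγ1 : γ < 1)
    (ρ : S → A → ℝ)
    (hflow : ∀ s a, ρ s a =
      (1 - γ) * μ0 s * π s a +
        γ * π s a * ∑ sh, ∑ ah, T sh ah s * ρ sh ah) :
    ∀ s a, ρ s a =
      (1 - γ) * ∑' t : ℕ, γ ^ t * (stateDist μ0 π T t s * π s a) := by
  obtain ⟨d, hd⟩ : ∃ d : S → ℝ, d = fun s =>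
      (1 - γ) * μ0 s + γ * ∑ sh, ∑ ah, T sh ah s * ρ sh ah := ⟨_, rfl⟩
  have hρ : ∀ s a, ρ s a = d s * π s a := by
    intro s a
    rw [hflow s a, hd]
    ring
  have hfix : d = fun s => (1 - γ) * μ0 s + γ * stateDist d π T 1 s := by
    funext s
    conv_lhs => rw [hd]
    simp only [stateDist]
    congr 2
    refine Finset.sum_congr rfl fun x _ => Finset.sum_congr rfl fun y _ => ?_
    rw [hρ x y]
    ring
  have hstep : ∀ n s, stateDist d π T n s =
      (1 - γ) * stateDist μ0 π T n s + γ * stateDist d π T (n + 1) s := by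
    intro n s
    conv_lhs => rw [hfix]
    rw [stateDist_lin π T μ0 (stateDist d π T 1), stateDist_shift]
  have hpart : ∀ n s, d s = (1 - γ) * (∑ t ∈ Finset.range n, γ ^ t * stateDist μ0 π T t s)
      + γ ^ n * stateDist d π T n s := by
    intro n s
    induction n with
    | zero => simp [stateDist]
    | succ n ih =>
      rw [Finset.sum_range_succ, ih, hstep n s]
      ring
  intro s a
  have hlim : Filter.Tendsto (fun n => γ ^ n * stateDist d π T n s) Filter.atTop (nhds 0) := by
    refine squeeze_zero_norm (a := fun n => γ ^ n * ∑ s, |d s|) (fun n => ?_) ?_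
    · rw [Real.norm_eq_abs, abs_mul, abs_of_nonneg (pow_nonneg hγ0.le n)]
      exact mul_le_mul_of_nonneg_left (stateDist_bound π hπ0 hπ1 T hT0 hT1 d n s)
        (pow_nonneg hγ0.le n)
    · simpa using (tendsto_pow_atTop_nhds_zero_of_lt_one hγ0.le hγ1).mul_const (∑ s, |d s|)
  have hsum : Summable fun t => γ ^ t * stateDist μ0 π T t s := by
    refine Summable.of_norm_bounded (g := fun n => γ ^ n * ∑ s, |μ0 s|)
      ((summable_geometric_of_lt_one hγ0.le hγ1).mul_right _) (fun n => ?_)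
    rw [Real.norm_eq_abs, abs_mul, abs_of_nonneg (pow_nonneg hγ0.le n)]
    exact mul_le_mul_of_nonneg_left (stateDist_bound π hπ0 hπ1 T hT0 hT1 μ0 n s)
      (pow_nonneg hγ0.le n)
  have h1 := (hsum.hasSum.tendsto_sum_nat.const_mul (1 - γ)).add hlim
  have h2 : d s = (1 - γ) * ∑' t, γ ^ t * stateDist μ0 π T t s := by
    have h3 := tendsto_nhds_unique (tendsto_const_nhds.congr fun n => hpart n s) h1
    rw [h3, add_zero]
  rw [hρ, h2, mul_assoc, ← tsum_mul_right]
  simp only [mul_assoc]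
end
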